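/- Let ω be a weight function with constants K (condition α) and b (condition γ), g ∈ 𝒮_ω(ℝᴺ) nonzero, 1 ≤ p ≤ ∞. For every λ ≥ 0 and μ > 2N/(b·(2p)′), and every f ∈ 𝒮_ω(ℝᴺ): ‖e^{λω} Rf‖_∞ ≤ D · ‖e^{2(K²λ+μ)ω} Sp_g f‖_p, where D = (2π)^{−2N} ‖g‖₂^{−4} e^{K(1+2K)λ} ‖e^{K²λω} g‖_∞ ‖e^{K²λω} ĝ‖_∞ ‖e^{−μω}‖_{L^{(2p)′}(ℝ^{2N})}², and (2p)′ is the exponent with 1/(2p) + 1/(2p)′ = 1 (with (2p)′ = 1 when p = ∞). -/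

import Mathlib

open MeasureTheory Complex ENNReal

noncomputable section

abbrev RN (N : ℕ) := Fin N → ℝ

def dotR {N : ℕ} (x y : RN N) : ℝ := ∑ i, x i * y i

def stft {N : ℕ} (g f : RN N → ℂ) (x ξ : RN N) : ℂ :=
  ∫ y, f y * (starRingEnd ℂ) (g (y - x)) * Complex.exp (-(Complex.I * (dotR y ξ : ℂ)))

def ftr {N : ℕ} (f : RN N → ℂ) (ξ : RN N) : ℂ :=
  ∫ x, Complex.exp (-(Complex.I * (dotR x ξ : ℂ))) * f x

def rihaczek {N : ℕ} (f : RN N → ℂ) (x ξ : RN N) : ℂ :=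
  Complex.exp (-(Complex.I * (dotR x ξ : ℂ))) * f x * (starRingEnd ℂ) (ftr f ξ)

def spec {N : ℕ} (g f : RN N → ℂ) (x ξ : RN N) : ℝ := ‖stft g f x ξ‖ ^ 2

def wig {N : ℕ} (τ : ℝ) (f : RN N → ℂ) (x ξ : RN N) : ℂ :=
  ∫ t, Complex.exp (-(Complex.I * (dotR t ξ : ℂ))) * f (x + τ • t) *
    (starRingEnd ℂ) (f (x - (1 - τ) • t))

structure WeightFunction where
  w : ℝ → ℝ
  K : ℝ
  a : ℝ
  b : ℝ
  oneLeK : 1 ≤ K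
  bpos : 0 < b
  cont : Continuous w
  mono : MonotoneOn w (Set.Ici 0)
  nonneg : ∀ t, 0 ≤ w t
  alpha : ∀ t, 0 ≤ t → w (2 * t) ≤ K * (1 + w t)
  beta : Filter.Tendsto (fun t => w t / t) Filter.atTop (nhds 0)
  gamma : ∀ t, 0 ≤ t → a + b * Real.log (1 + t) ≤ w t
  delta : ConvexOn ℝ Set.univ (fun t => w (Real.exp t))
  subadd : ∀ s t, 0 ≤ s → 0 ≤ t → w (s + t) ≤ K * (1 + w s + w t)

def wnorm (W : WeightFunction) (lam : ℝ) {E : Type*} [NormedAddCommGroup E]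
    [MeasurableSpace E] (μ : Measure E) {F : Type*} [NormedAddCommGroup F]
    (f : E → F) (p : ℝ≥0∞) : ℝ≥0∞ :=
  eLpNorm (fun t => Real.exp (lam * W.w ‖t‖) * ‖f t‖) p μ

def SOmega {N : ℕ} (W : WeightFunction) (f : RN N → ℂ) : Prop :=
  ∀ lam : ℝ, 0 < lam →
    (∃ C, ∀ x, Real.exp (lam * W.w ‖x‖) * ‖f x‖ ≤ C) ∧
    (∃ C, ∀ ξ, Real.exp (lam * W.w ‖ξ‖) * ‖ftr f ξ‖ ≤ C)

def elpN {α : Type*} [MeasurableSpace α] (μ : Measure α) (h : α → ℝ≥0∞) (p : ℝ≥0∞) : ℝ≥0∞ :=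
  if p = ∞ then essSup h μ else (∫⁻ z, (h z) ^ p.toReal ∂μ) ^ (1 / p.toReal)

end

open scoped FourierTransform

theorem lintegral_comp_two_pi_smul {N : ℕ} (F : RN N → ℝ≥0∞) :
    ∫⁻ ξ, F ((2 * Real.pi) • ξ) = ENNReal.ofReal (((2 * Real.pi) ^ N)⁻¹) * ∫⁻ ξ, F ξ := by
  have h0 : (2 * Real.pi) ≠ 0 := by positivity
  have h := lintegral_map_equiv (μ := (volume : Measure (RN N))) F
    (Homeomorph.smulOfNeZero (2 * Real.pi) h0).toMeasurableEquiv
  have hm := Measure.map_addHaar_smul (volume : Measure (RN N)) h0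
  have h2 : (((Homeomorph.smulOfNeZero (2 * Real.pi) h0).toMeasurableEquiv : RN N ≃ᵐ RN N) :
      RN N → RN N) = fun x => (2 * Real.pi) • x := rfl
  rw [h2] at h
  change Measure.map (fun x => (2 * Real.pi) • x) _ = _ at hm
  rw [hm, lintegral_smul_measure] at h
  rw [← h, smul_eq_mul, abs_of_nonneg (by positivity)]
  simp

theorem fourier_comp_ofLp {N : ℕ} (h : RN N → ℂ) (ξ : EuclideanSpace ℝ (Fin N)) :
    𝓕 (fun v : EuclideanSpace ℝ (Fin N) => h (WithLp.ofLp v)) ξ =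
      ftr h ((2 * Real.pi) • WithLp.ofLp ξ) := by
  rw [Real.fourier_eq', ftr, ← (PiLp.volume_preserving_ofLp (Fin N)).integral_comp
    (MeasurableEquiv.toLp 2 (Fin N → ℝ)).symm.measurableEmbedding]
  refine integral_congr_ae (.of_forall fun v => ?_)
  simp only [smul_eq_mul]
  congr 2
  simp only [dotR, PiLp.inner_apply, Pi.smul_apply, smul_eq_mul]
  push_cast
  rw [Finset.mul_sum, Finset.sum_mul, Finset.mul_sum, ← Finset.sum_neg_distrib]
  refine Finset.sum_congr rfl fun i _ => ?_
  simp
  ring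

theorem lintegral_comp_ofLp {N : ℕ} (F : RN N → ℝ≥0∞) :
    ∫⁻ v : EuclideanSpace ℝ (Fin N), F (WithLp.ofLp v) = ∫⁻ x, F x :=
  (PiLp.volume_preserving_ofLp (Fin N)).lintegral_comp_emb
    (MeasurableEquiv.toLp 2 (Fin N → ℝ)).symm.measurableEmbedding F

theorem lintegral_enorm_fourier_comp_ofLp {N : ℕ} (h : RN N → ℂ) (F : ℂ → ℝ≥0∞) :
    ∫⁻ ξ, F (𝓕 (fun v : EuclideanSpace ℝ (Fin N) => h (WithLp.ofLp v)) ξ) =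
      ENNReal.ofReal (((2 * Real.pi) ^ N)⁻¹) * ∫⁻ ξ, F (ftr h ξ) := by
  simp_rw [fourier_comp_ofLp]
  rw [lintegral_comp_ofLp (fun x : RN N => F (ftr h ((2 * Real.pi) • x))),
    lintegral_comp_two_pi_smul (fun x : RN N => F (ftr h x))]

/-- Fourier inversion bounds a continuous integrable function by the `L¹` norm of its transform,
which may be infinite. -/
theorem enorm_le_lintegral_enorm_ftr {N : ℕ} {h : RN N → ℂ} (hc : Continuous h)
    (hi : Integrable h) (y : RN N) :
    ‖h y‖ₑ ≤ ENNReal.ofReal (((2 * Real.pi) ^ N)⁻¹) * ∫⁻ ξ, ‖ftr h ξ‖ₑ := by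
  rw [← lintegral_enorm_fourier_comp_ofLp h (fun z => ‖z‖ₑ)]
  set H : EuclideanSpace ℝ (Fin N) → ℂ := fun v => h (WithLp.ofLp v)
  have hHc : Continuous H := hc.comp (PiLp.continuous_ofLp 2 _)
  have hHi : Integrable H := (PiLp.volume_preserving_ofLp (Fin N)).integrable_comp_of_integrable hi
  by_cases hF : Integrable (𝓕 H)
  · have h1 : 𝓕⁻ (𝓕 H) (WithLp.toLp 2 y) = h y := by
      rw [hHc.fourierInv_fourier_eq hHi hF]
    rw [← h1, Real.fourierInv_eq']
    refine (enorm_integral_le_lintegral_enorm _).trans_eq (lintegral_congr fun v => ?_)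
    rw [enorm_smul]
    have : ‖Complex.exp ((2 * Real.pi * inner ℝ v (WithLp.toLp 2 y) : ℝ) * Complex.I)‖ₑ = 1 := by
      rw [← ofReal_norm, Complex.norm_exp_ofReal_mul_I]; simp
    rw [this, one_mul]
  · have hcont : Continuous (𝓕 H) :=
      VectorFourier.fourierIntegral_continuous Real.continuous_fourierChar
        (by exact continuous_inner) hHi
    have : ∫⁻ ξ, ‖𝓕 H ξ‖ₑ = ⊤ := by
      by_contra hne
      exact hF ⟨hcont.aestronglyMeasurable, lt_top_iff_ne_top.2 hne⟩
    rw [this]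
    exact le_top

/-- Plancherel's identity for the transform `ftr`. -/
theorem lintegral_enorm_ftr_sq {N : ℕ} (g : SchwartzMap (RN N) ℂ) :
    ENNReal.ofReal (((2 * Real.pi) ^ N)⁻¹) * ∫⁻ ξ, ‖ftr g ξ‖ₑ ^ 2 = ∫⁻ x, ‖g x‖ₑ ^ 2 := by
  rw [← lintegral_enorm_fourier_comp_ofLp g (fun z => ‖z‖ₑ ^ 2),
    ← lintegral_comp_ofLp (fun x => ‖g x‖ₑ ^ 2)]
  let G : SchwartzMap (EuclideanSpace ℝ (Fin N)) ℂ :=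
    SchwartzMap.compCLMOfContinuousLinearEquiv ℂ (EuclideanSpace.equiv (Fin N) ℝ) g
  have key (u : SchwartzMap (EuclideanSpace ℝ (Fin N)) ℂ) :
      ∫⁻ x, ‖u x‖ₑ ^ 2 = ENNReal.ofReal (∫ x, ‖u x‖ ^ 2) := by
    have hu : Integrable (fun x => ‖u x‖ ^ 2) :=
      (memLp_two_iff_integrable_sq_norm u.continuous.aestronglyMeasurable).1 (u.memLp 2)
    rw [ofReal_integral_eq_lintegral_ofReal hu (.of_forall fun _ => by positivity)]
    refine lintegral_congr fun x => ?_
    rw [ENNReal.ofReal_pow (norm_nonneg _), ofReal_norm]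
  have h1 := key G
  have h2 := key (𝓕 G)
  rw [SchwartzMap.integral_norm_sq_fourier, ← h1, SchwartzMap.fourier_coe] at h2
  exact h2

theorem enorm_cexp_neg_I_mul_ofReal (t : ℝ) : ‖Complex.exp (-(Complex.I * (t : ℂ)))‖ₑ = 1 := by
  have h : -(Complex.I * (t : ℂ)) = ((-t : ℝ) : ℂ) * Complex.I := by push_cast; ring
  rw [h, ← ofReal_norm, Complex.norm_exp_ofReal_mul_I, ENNReal.ofReal_one]

theorem continuous_dotR {N : ℕ} : Continuous fun q : RN N × RN N => dotR q.1 q.2 := by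
  unfold dotR
  fun_prop

theorem dotR_add_left {N : ℕ} (x y z : RN N) : dotR (x + y) z = dotR x z + dotR y z := by
  simp [dotR, add_mul, Finset.sum_add_distrib]

theorem dotR_add_right {N : ℕ} (x y z : RN N) : dotR x (y + z) = dotR x y + dotR x z := by
  simp [dotR, mul_add, Finset.sum_add_distrib]

theorem stronglyMeasurable_stft {N : ℕ} (g f : SchwartzMap (RN N) ℂ) :
    StronglyMeasurable fun z : RN N × RN N => stft g f z.1 z.2 := by
  refine StronglyMeasurable.integral_prod_right (f := fun z : RN N × RN N => fun y =>
    f y * (starRingEnd ℂ) (g (y - z.1)) * Complex.exp (-(Complex.I * (dotR y z.2 : ℂ)))) ?_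
  refine Continuous.stronglyMeasurable ?_
  have hd : Continuous fun q : (RN N × RN N) × RN N => dotR q.2 q.1.2 :=
    continuous_dotR.comp (continuous_snd.prodMk (continuous_snd.comp continuous_fst))
  have hf := f.continuous
  have hg := g.continuous
  have hs := Complex.continuous_conj
  simp only [Function.uncurry_def]
  fun_prop

theorem stft_eq_ftr {N : ℕ} (g f : RN N → ℂ) (u η : RN N) :
    stft g f u η = ftr (fun y => f y * (starRingEnd ℂ) (g (y - u))) η := by
  simp only [stft, ftr, mul_comm]

/-- The Fourier transform of the short-time Fourier transform in its first variable. -/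
theorem ftr_stft {N : ℕ} (g f : SchwartzMap (RN N) ℂ) (ζ η : RN N) :
    ftr (fun u => stft g f u η) ζ = ftr f (ζ + η) * (starRingEnd ℂ) (ftr g ζ) := by
  have hint : Integrable (fun q : RN N × RN N =>
      Complex.exp (-(Complex.I * (dotR q.1 ζ : ℂ))) * (f q.2 * (starRingEnd ℂ) (g (q.2 - q.1)) *
        Complex.exp (-(Complex.I * (dotR q.2 η : ℂ))))) (volume.prod volume) := by
    have hg' : Integrable (fun t => (starRingEnd ℂ) (g (-t))) := by
      have h1 : Integrable (fun t => g (-t)) := g.integrable.comp_neg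
      exact h1.norm.mono' ((Complex.continuous_conj.comp
        (g.continuous.comp continuous_neg)).aestronglyMeasurable) (.of_forall fun t => by simp)
    have h := (f.integrable (μ := volume)).convolution_integrand (ContinuousLinearMap.mul ℂ ℂ) hg'
    refine h.norm.mono' ?_ (.of_forall fun q => ?_)
    · refine Continuous.aestronglyMeasurable ?_
      have hd (x : RN N) : Continuous fun q : RN N => dotR q x :=
        continuous_dotR.comp (continuous_id.prodMk continuous_const)
      have hd1 := hd ζ
      have hd2 := hd η
      have hf := f.continuous
      have hg := g.continuous
      have hs := Complex.continuous_conj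
      fun_prop
    · have hn (t : ℝ) : ‖Complex.exp (-(Complex.I * (t : ℂ)))‖ = 1 := by
        have := enorm_cexp_neg_I_mul_ofReal t
        rwa [← ofReal_norm, ENNReal.ofReal_eq_one] at this
      simp [hn]
  have hconj (z : ℝ) : (starRingEnd ℂ) (Complex.exp (-(Complex.I * (z : ℂ)))) =
      Complex.exp (Complex.I * (z : ℂ)) := by
    rw [← Complex.exp_conj]
    simp
  have hinner (y : RN N) : ∫ u, Complex.exp (-(Complex.I * (dotR u ζ : ℂ))) *
      (starRingEnd ℂ) (g (y - u)) =
      Complex.exp (-(Complex.I * (dotR y ζ : ℂ))) * (starRingEnd ℂ) (ftr g ζ) := by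
    rw [ftr, ← integral_conj, ← integral_const_mul, ← integral_sub_left_eq_self _ _ y]
    refine integral_congr_ae (.of_forall fun u => ?_)
    simp only [map_mul, hconj]
    rw [← mul_assoc, ← Complex.exp_add]
    have : dotR y ζ = dotR (y - u) ζ + dotR u ζ := by rw [← dotR_add_left, sub_add_cancel]
    have hyu : y - (y - u) = u := by
      ext i
      simp
    rw [this]
    congr 2
    · push_cast
      ring
    · exact congrArg g hyu
  calc ftr (fun u => stft g f u η) ζ
      = ∫ u, ∫ y, Complex.exp (-(Complex.I * (dotR u ζ : ℂ))) * (f y *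
        (starRingEnd ℂ) (g (y - u)) * Complex.exp (-(Complex.I * (dotR y η : ℂ)))) := by
        simp only [ftr, stft, integral_const_mul]
    _ = ∫ y, ∫ u, Complex.exp (-(Complex.I * (dotR u ζ : ℂ))) * (f y *
        (starRingEnd ℂ) (g (y - u)) * Complex.exp (-(Complex.I * (dotR y η : ℂ)))) :=
        integral_integral_swap hint
    _ = ∫ y, (Complex.exp (-(Complex.I * (dotR y (ζ + η) : ℂ))) * f y) *
        (starRingEnd ℂ) (ftr g ζ) := by
        refine integral_congr_ae (.of_forall fun y => ?_)
        have : ∀ u, Complex.exp (-(Complex.I * (dotR u ζ : ℂ))) * (f y *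
            (starRingEnd ℂ) (g (y - u)) * Complex.exp (-(Complex.I * (dotR y η : ℂ)))) =
            (f y * Complex.exp (-(Complex.I * (dotR y η : ℂ)))) *
            (Complex.exp (-(Complex.I * (dotR u ζ : ℂ))) * (starRingEnd ℂ) (g (y - u))) := by
          intro u; ring
        simp only [this, integral_const_mul, hinner]
        have he : Complex.exp (-(Complex.I * (dotR y (ζ + η) : ℂ))) =
            Complex.exp (-(Complex.I * (dotR y ζ : ℂ))) *
            Complex.exp (-(Complex.I * (dotR y η : ℂ))) := by
          rw [← Complex.exp_add, dotR_add_right]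
          congr 1
          push_cast
          ring
        rw [he]
        ring
    _ = _ := integral_mul_const _ _

theorem enorm_mul_window_le {N : ℕ} (g f : SchwartzMap (RN N) ℂ) (x u : RN N) :
    ‖f x‖ₑ * ‖g (x - u)‖ₑ ≤
      ENNReal.ofReal (((2 * Real.pi) ^ N)⁻¹) * ∫⁻ η, ‖stft g f u η‖ₑ := by
  have hg : Continuous fun y => (starRingEnd ℂ) (g (y - u)) :=
    Complex.continuous_conj.comp (g.continuous.comp (continuous_id.sub continuous_const))
  have hi : Integrable fun y => f y * (starRingEnd ℂ) (g (y - u)) := by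
    refine f.integrable.mul_bdd (c := SchwartzMap.seminorm ℝ 0 0 g) hg.aestronglyMeasurable
      (.of_forall fun y => ?_)
    simpa using SchwartzMap.norm_le_seminorm ℝ g (y - u)
  have h := enorm_le_lintegral_enorm_ftr (f.continuous.mul hg) hi x
  simp_rw [stft_eq_ftr]
  simpa [enorm_mul] using! h

theorem enorm_ftr_mul_window_le {N : ℕ} (g f : SchwartzMap (RN N) ℂ) (ξ η : RN N) :
    ‖ftr f ξ‖ₑ * ‖ftr g (ξ - η)‖ₑ ≤ ∫⁻ u, ‖stft g f u η‖ₑ := by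
  have h := ftr_stft g f (ξ - η) η
  rw [sub_add_cancel] at h
  have h2 : ‖ftr (fun u => stft g f u η) (ξ - η)‖ₑ = ‖ftr f ξ‖ₑ * ‖ftr g (ξ - η)‖ₑ := by
    rw [h, enorm_mul, RCLike.enorm_conj]
  rw [← h2]
  refine (enorm_integral_le_lintegral_enorm _).trans_eq (lintegral_congr fun u => ?_)
  rw [enorm_mul, enorm_cexp_neg_I_mul_ofReal, one_mul]

/-- A pointwise bound of `a * ‖φ (x - u)‖ₑ` integrates to a bound with weights. -/
theorem weight_mul_lintegral_sq_le {N : ℕ} (W : WeightFunction) {s : ℝ} (hs : 0 ≤ s)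
    (φ : RN N → ℂ) (a c : ℝ≥0∞) (hc : c ≠ ⊤)
    (x : RN N) (M : RN N → ℝ≥0∞) (h : ∀ u, a * ‖φ (x - u)‖ₑ ≤ c * M u) (ha : a ≠ ⊤)
    (hφ : wnorm W (W.K * s) volume φ ⊤ ≠ ⊤) :
    ENNReal.ofReal (Real.exp (s * W.w ‖x‖)) * a * ∫⁻ t, ‖φ t‖ₑ ^ 2 ≤
      c * ENNReal.ofReal (Real.exp (W.K * s)) * wnorm W (W.K * s) volume φ ⊤ *
        ∫⁻ u, ENNReal.ofReal (Real.exp (W.K * s * W.w ‖u‖)) * M u := by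
  have hae : ∀ᵐ u : RN N, ENNReal.ofReal (Real.exp (W.K * s * W.w ‖x - u‖)) * ‖φ (x - u)‖ₑ ≤
      wnorm W (W.K * s) volume φ ⊤ := by
    have h0 : ∀ᵐ t : RN N, ENNReal.ofReal (Real.exp (W.K * s * W.w ‖t‖)) * ‖φ t‖ₑ ≤
        wnorm W (W.K * s) volume φ ⊤ := by
      have h1 := ae_le_eLpNormEssSup (μ := volume)
        (f := fun t : RN N => Real.exp (W.K * s * W.w ‖t‖) * ‖φ t‖)
      rw [← eLpNorm_exponent_top] at h1
      filter_upwards [h1] with t ht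
      rwa [enorm_mul, enorm_norm, Real.enorm_of_nonneg (Real.exp_nonneg _)] at ht
    exact (Measure.measurePreserving_sub_left volume x).quasiMeasurePreserving.ae h0
  have hexp (u : RN N) : ENNReal.ofReal (Real.exp (s * W.w ‖x‖)) ≤
      ENNReal.ofReal (Real.exp (W.K * s)) * ENNReal.ofReal (Real.exp (W.K * s * W.w ‖x - u‖)) *
        ENNReal.ofReal (Real.exp (W.K * s * W.w ‖u‖)) := by
    rw [← ENNReal.ofReal_mul (by positivity), ← ENNReal.ofReal_mul (by positivity),
      ← Real.exp_add, ← Real.exp_add]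
    refine ENNReal.ofReal_le_ofReal (Real.exp_le_exp.2 ?_)
    have h1 : W.w ‖x‖ ≤ W.w (‖x - u‖ + ‖u‖) := by
      refine W.mono (norm_nonneg _) (by simp; positivity) ?_
      simpa using norm_add_le (x - u) u
    have h2 := W.subadd ‖x - u‖ ‖u‖ (norm_nonneg _) (norm_nonneg _)
    calc s * W.w ‖x‖ ≤ s * (W.K * (1 + W.w ‖x - u‖ + W.w ‖u‖)) := by gcongr; exact h1.trans h2
      _ = _ := by ring
  rw [← lintegral_sub_left_eq_self (fun t => ‖φ t‖ₑ ^ 2) x, ← lintegral_const_mul' _ _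
    (ENNReal.mul_ne_top ENNReal.ofReal_ne_top ha), ← lintegral_const_mul' _ _
    (by finiteness)]
  refine lintegral_mono_ae ?_
  filter_upwards [hae] with u hu
  calc ENNReal.ofReal (Real.exp (s * W.w ‖x‖)) * a * ‖φ (x - u)‖ₑ ^ 2
      ≤ (ENNReal.ofReal (Real.exp (W.K * s)) * ENNReal.ofReal (Real.exp (W.K * s * W.w ‖x - u‖)) *
        ENNReal.ofReal (Real.exp (W.K * s * W.w ‖u‖))) * a * ‖φ (x - u)‖ₑ ^ 2 := by
        gcongr; exact hexp u
    _ = ENNReal.ofReal (Real.exp (W.K * s)) * (ENNReal.ofReal (Real.exp (W.K * s * W.w ‖x - u‖)) *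
        ‖φ (x - u)‖ₑ) * ENNReal.ofReal (Real.exp (W.K * s * W.w ‖u‖)) * (a * ‖φ (x - u)‖ₑ) := by
        ring
    _ ≤ ENNReal.ofReal (Real.exp (W.K * s)) * wnorm W (W.K * s) volume φ ⊤ *
        ENNReal.ofReal (Real.exp (W.K * s * W.w ‖u‖)) * (c * M u) :=
        mul_le_mul' (by gcongr) (h u)
    _ = _ := by ring

theorem wnorm_top_ne_top {N : ℕ} (W : WeightFunction) (φ : RN N → ℂ) {s C : ℝ}
    (h : ∀ x, Real.exp ((s + 1) * W.w ‖x‖) * ‖φ x‖ ≤ C) : wnorm W s volume φ ⊤ ≠ ⊤ := by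
  rw [wnorm, eLpNorm_exponent_top]
  refine ((eLpNormEssSup_le_of_ae_bound (C := C) (.of_forall fun x => ?_)).trans_lt
    ENNReal.ofReal_lt_top).ne
  rw [norm_mul, norm_norm, Real.norm_of_nonneg (Real.exp_nonneg _)]
  refine le_trans ?_ (h x)
  gcongr
  · exact W.nonneg _
  · linarith

theorem eLpNorm_exp_neg_ne_top {N : ℕ} (W : WeightFunction) {r : ℝ≥0∞} (hr0 : r ≠ 0) (hr : r ≠ ⊤)
    {μ : ℝ} (hμ : 2 * (N : ℝ) / (W.b * r.toReal) < μ) :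
    eLpNorm (fun z : RN N × RN N => Real.exp (-(μ * W.w ‖z‖))) r volume ≠ ⊤ := by
  have hrp : 0 < r.toReal := ENNReal.toReal_pos hr0 hr
  have hbr : 0 < W.b * r.toReal := mul_pos W.bpos hrp
  have hμ0 : 0 ≤ μ := le_trans (by positivity) hμ.le
  refine (eLpNorm_lt_top_iff_lintegral_rpow_enorm_lt_top hr0 hr |>.2 ?_).ne
  have hdim : (Module.finrank ℝ (RN N × RN N) : ℝ) < μ * (W.b * r.toReal) := by
    rw [div_lt_iff₀ hbr] at hμ
    simpa [Module.finrank_prod, two_mul] using hμ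
  have : (volume : Measure (RN N × RN N)).IsAddHaarMeasure := by
    exact Measure.prod.instIsAddHaarMeasure _ _
  have hfin := finite_integral_one_add_norm (μ := (volume : Measure (RN N × RN N))) hdim
  have hC : ENNReal.ofReal (Real.exp (-(μ * W.a * r.toReal))) ≠ ⊤ := ENNReal.ofReal_ne_top
  refine lt_of_le_of_lt ?_ (ENNReal.mul_lt_top hC.lt_top hfin)
  rw [← lintegral_const_mul' _ _ hC]
  refine lintegral_mono fun z => ?_
  rw [Real.enorm_of_nonneg (Real.exp_nonneg _), ENNReal.ofReal_rpow_of_nonneg (Real.exp_nonneg _)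
    hrp.le, ← ENNReal.ofReal_mul (Real.exp_nonneg _), ← Real.exp_mul,
    Real.rpow_def_of_pos (by positivity), ← Real.exp_add]
  refine ENNReal.ofReal_le_ofReal (Real.exp_le_exp.2 ?_)
  have h := mul_le_mul_of_nonneg_left (W.gamma ‖z‖ (norm_nonneg z)) (mul_nonneg hμ0 hrp.le)
  linarith

/-- Hölder's inequality for the weighted `L¹` norm of the short-time Fourier transform. -/
theorem sq_lintegral_weight_stft_le {N : ℕ} (W : WeightFunction) (g f : SchwartzMap (RN N) ℂ)
    {p r : ℝ≥0∞} (hr : 1 / (2 * p) + 1 / r = 1) (κ μ : ℝ) :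
    (∫⁻ z : RN N × RN N, ENNReal.ofReal (Real.exp (κ * W.w ‖z‖)) * ‖stft g f z.1 z.2‖ₑ) ^ 2 ≤
      eLpNorm (fun z : RN N × RN N => Real.exp (-(μ * W.w ‖z‖))) r volume ^ 2 *
        wnorm W (2 * (κ + μ)) volume (fun z : RN N × RN N => spec g f z.1 z.2) p := by
  have hw := W.cont
  have : HolderTriple r (2 * p) 1 := ⟨by simpa [add_comm] using hr⟩
  set F : RN N × RN N → ℝ := fun z => Real.exp ((κ + μ) * W.w ‖z‖) * ‖stft g f z.1 z.2‖ with hF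
  have hFm : AEStronglyMeasurable F volume :=
    (Continuous.aestronglyMeasurable (by fun_prop)).mul
      (stronglyMeasurable_stft g f).norm.aestronglyMeasurable
  have hEm : AEStronglyMeasurable (fun z : RN N × RN N => Real.exp (-(μ * W.w ‖z‖))) volume :=
    Continuous.aestronglyMeasurable (by fun_prop)
  have h1 := eLpNorm_smul_le_mul_eLpNorm (r := 1) (p := r) (q := 2 * p) hFm hEm
  have h2 : eLpNorm ((fun z : RN N × RN N => Real.exp (-(μ * W.w ‖z‖))) • F) 1 volume =
      ∫⁻ z : RN N × RN N, ENNReal.ofReal (Real.exp (κ * W.w ‖z‖)) * ‖stft g f z.1 z.2‖ₑ := by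
    rw [eLpNorm_one_eq_lintegral_enorm]
    refine lintegral_congr fun z => ?_
    rw [Pi.smul_apply', smul_eq_mul, hF, ← mul_assoc, ← Real.exp_add, enorm_mul, enorm_norm,
      Real.enorm_of_nonneg (Real.exp_nonneg _)]
    congr 4
    ring
  have h3 : wnorm W (2 * (κ + μ)) volume (fun z : RN N × RN N => spec g f z.1 z.2) p =
      eLpNorm F (2 * p) volume ^ 2 := by
    have h4 := eLpNorm_norm_rpow (p := p) (μ := volume) F (q := 2) two_pos
    rw [ENNReal.ofReal_ofNat, mul_comm p, ENNReal.rpow_two] at h4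
    rw [← h4, wnorm]
    congr 1
    funext z
    rw [Real.rpow_two, hF, norm_mul, mul_pow, norm_norm, Real.norm_of_nonneg (Real.exp_nonneg _),
      ← Real.exp_nat_mul, spec, Real.norm_of_nonneg (by positivity)]
    congr 2
    push_cast
    ring
  rw [h3, ← mul_pow, ← h2]
  gcongr

theorem aemeasurable_weight_mul_stft {N : ℕ} (W : WeightFunction) (g f : SchwartzMap (RN N) ℂ)
    (κ : ℝ) : AEMeasurable (fun z : RN N × RN N =>
      ENNReal.ofReal (Real.exp (κ * W.w ‖z‖)) * ‖stft g f z.1 z.2‖ₑ) (volume.prod volume) := by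
  have hw := W.cont
  exact (Continuous.measurable (by fun_prop)).ennreal_ofReal.aemeasurable.mul
    (stronglyMeasurable_stft g f).enorm.aemeasurable

theorem lintegral_weight_fst_stft_le {N : ℕ} (W : WeightFunction) (g f : SchwartzMap (RN N) ℂ)
    {κ : ℝ} (hκ : 0 ≤ κ) :
    ∫⁻ u : RN N, ENNReal.ofReal (Real.exp (κ * W.w ‖u‖)) * ∫⁻ η, ‖stft g f u η‖ₑ ≤
      ∫⁻ z : RN N × RN N, ENNReal.ofReal (Real.exp (κ * W.w ‖z‖)) * ‖stft g f z.1 z.2‖ₑ := by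
  rw [Measure.volume_eq_prod, lintegral_prod _ (aemeasurable_weight_mul_stft W g f κ)]
  refine lintegral_mono fun u => ?_
  rw [← lintegral_const_mul' _ _ ENNReal.ofReal_ne_top]
  refine lintegral_mono fun η => ?_
  gcongr
  exact W.mono (norm_nonneg _) (norm_nonneg _) (norm_fst_le (u, η))

theorem lintegral_weight_snd_stft_le {N : ℕ} (W : WeightFunction) (g f : SchwartzMap (RN N) ℂ)
    {κ : ℝ} (hκ : 0 ≤ κ) :
    ∫⁻ η : RN N, ENNReal.ofReal (Real.exp (κ * W.w ‖η‖)) * ∫⁻ u, ‖stft g f u η‖ₑ ≤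
      ∫⁻ z : RN N × RN N, ENNReal.ofReal (Real.exp (κ * W.w ‖z‖)) * ‖stft g f z.1 z.2‖ₑ := by
  rw [Measure.volume_eq_prod, lintegral_prod_symm _ (aemeasurable_weight_mul_stft W g f κ)]
  refine lintegral_mono fun η => ?_
  rw [← lintegral_const_mul' _ _ ENNReal.ofReal_ne_top]
  refine lintegral_mono fun u => ?_
  gcongr
  exact W.mono (norm_nonneg _) (norm_nonneg _) (norm_snd_le (u, η))

theorem lintegral_enorm_sq_eq_eLpNorm_sq {N : ℕ} (g : RN N → ℂ) :
    ∫⁻ t, ‖g t‖ₑ ^ 2 = eLpNorm g 2 volume ^ 2 := by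
  rw [eLpNorm_eq_lintegral_rpow_enorm_toReal two_ne_zero ENNReal.ofNat_ne_top,
    ← ENNReal.rpow_two, ← ENNReal.rpow_mul]
  simp

theorem ne_zero_and_ne_top_of_holder {p r : ℝ≥0∞} (hp : 1 ≤ p)
    (hr : 1 / (2 * p) + 1 / r = 1) : r ≠ 0 ∧ r ≠ ⊤ := by
  constructor
  · rintro rfl
    simp at hr
  · rintro rfl
    have h2p : (2 : ℝ≥0∞) ≤ 2 * p := le_mul_of_one_le_right' hp
    have h2 : 1 / (2 * p) ≤ 2⁻¹ := by
      rw [one_div]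
      exact ENNReal.inv_le_inv.2 h2p
    have h1 : 1 / (2 * p) = 1 := by simpa using hr
    rw [h1] at h2
    exact absurd h2 (not_le.2 ENNReal.one_half_lt_one)

/-- The weighted sup norm of `rihaczek f` is controlled by the square of the weighted `L¹` norm of
the short-time Fourier transform. -/
theorem pow_mul_enorm_weight_rihaczek_le {N : ℕ} (W : WeightFunction)
    (g f : SchwartzMap (RN N) ℂ) {lam κ : ℝ} (hlam : 0 ≤ lam) (hκ : W.K * (W.K * lam) = κ)
    (hG : wnorm W κ volume g ⊤ ≠ ⊤) (hH : wnorm W κ volume (ftr g) ⊤ ≠ ⊤) (x ξ : RN N) :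
    eLpNorm g 2 volume ^ 4 * ‖Real.exp (lam * W.w ‖(x, ξ)‖) * ‖rihaczek f x ξ‖‖ₑ ≤
      ENNReal.ofReal (((2 * Real.pi) ^ (2 * N))⁻¹) *
        ENNReal.ofReal (Real.exp (W.K * lam + 2 * κ)) *
        wnorm W κ volume g ⊤ * wnorm W κ volume (ftr g) ⊤ *
        (∫⁻ z : RN N × RN N,
          ENNReal.ofReal (Real.exp (κ * W.w ‖z‖)) * ‖stft g f z.1 z.2‖ₑ) ^ 2 := by
  have hK := W.oneLeK
  have hs : 0 ≤ W.K * lam := by positivity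
  have hκ0 : 0 ≤ κ := hκ ▸ by positivity
  have hx := weight_mul_lintegral_sq_le W hs g ‖f x‖ₑ _ ENNReal.ofReal_ne_top x
    (fun u => ∫⁻ η, ‖stft g f u η‖ₑ) (enorm_mul_window_le g f x) enorm_ne_top (by rwa [hκ])
  have hξ := weight_mul_lintegral_sq_le W hs (ftr g) ‖ftr f ξ‖ₑ 1 ENNReal.one_ne_top ξ
    (fun η => ∫⁻ u, ‖stft g f u η‖ₑ)
    (fun η => by simpa using enorm_ftr_mul_window_le g f ξ η) enorm_ne_top (by rwa [hκ])
  rw [hκ] at hx hξ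
  replace hx := hx.trans (mul_le_mul_right (lintegral_weight_fst_stft_le W g f hκ0) _)
  replace hξ := hξ.trans (mul_le_mul_right (lintegral_weight_snd_stft_le W g f hκ0) _)
  have hAB := lintegral_enorm_ftr_sq g
  rw [lintegral_enorm_sq_eq_eLpNorm_sq g] at hx hAB
  generalize wnorm W κ volume g ⊤ = G at *
  generalize wnorm W κ volume (ftr g) ⊤ = H at *
  generalize (∫⁻ z : RN N × RN N,
    ENNReal.ofReal (Real.exp (κ * W.w ‖z‖)) * ‖stft g f z.1 z.2‖ₑ) = J at *
  generalize (∫⁻ t, ‖ftr g t‖ₑ ^ 2) = B at *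
  generalize eLpNorm g 2 volume = A at *
  have hexp : ENNReal.ofReal (Real.exp (lam * W.w ‖(x, ξ)‖)) ≤
      ENNReal.ofReal (Real.exp (W.K * lam)) * ENNReal.ofReal (Real.exp (W.K * lam * W.w ‖x‖)) *
        ENNReal.ofReal (Real.exp (W.K * lam * W.w ‖ξ‖)) := by
    rw [← ENNReal.ofReal_mul (by positivity), ← ENNReal.ofReal_mul (by positivity),
      ← Real.exp_add, ← Real.exp_add]
    refine ENNReal.ofReal_le_ofReal (Real.exp_le_exp.2 ?_)
    have h1 : W.w ‖(x, ξ)‖ ≤ W.w (‖x‖ + ‖ξ‖) := by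
      refine W.mono (norm_nonneg _) (add_nonneg (norm_nonneg _) (norm_nonneg _)) ?_
      exact max_le_add_of_nonneg (norm_nonneg _) (norm_nonneg _)
    calc lam * W.w ‖(x, ξ)‖ ≤ lam * (W.K * (1 + W.w ‖x‖ + W.w ‖ξ‖)) := by
          gcongr
          exact h1.trans (W.subadd _ _ (norm_nonneg _) (norm_nonneg _))
      _ = _ := by ring
  have hc : ENNReal.ofReal (((2 * Real.pi) ^ (2 * N))⁻¹) =
      ENNReal.ofReal (((2 * Real.pi) ^ N)⁻¹) ^ 2 := by
    rw [← ENNReal.ofReal_pow (by positivity), inv_pow, ← pow_mul, mul_comm N]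
  have hE : ENNReal.ofReal (Real.exp (W.K * lam + 2 * κ)) =
      ENNReal.ofReal (Real.exp (W.K * lam)) * ENNReal.ofReal (Real.exp κ) ^ 2 := by
    rw [← ENNReal.ofReal_pow (by positivity), ← ENNReal.ofReal_mul (by positivity),
      ← Real.exp_nat_mul, ← Real.exp_add]
    norm_num
  rw [hc, hE, enorm_mul, enorm_norm, Real.enorm_of_nonneg (Real.exp_nonneg _), rihaczek, enorm_mul,
    enorm_mul, enorm_cexp_neg_I_mul_ofReal, one_mul, RCLike.enorm_conj]
  generalize ENNReal.ofReal (((2 * Real.pi) ^ N)⁻¹) = c at *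
  generalize ENNReal.ofReal (Real.exp κ) = E1 at *
  generalize ENNReal.ofReal (Real.exp (W.K * lam)) = E0 at *
  generalize ENNReal.ofReal (Real.exp (W.K * lam * W.w ‖x‖)) = X at *
  generalize ENNReal.ofReal (Real.exp (W.K * lam * W.w ‖ξ‖)) = Y at *
  calc _ ≤ A ^ 4 * ((E0 * X * Y) * (‖f x‖ₑ * ‖ftr f ξ‖ₑ)) := by gcongr
    _ = E0 * (X * ‖f x‖ₑ * A ^ 2) * (Y * ‖ftr f ξ‖ₑ * A ^ 2) := by ring
    _ = c * E0 * ((X * ‖f x‖ₑ * A ^ 2) * (Y * ‖ftr f ξ‖ₑ * B)) := by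
      nth_rewrite 2 [← hAB]
      ring
    _ ≤ c * E0 * ((c * E1 * G * J) * (1 * E1 * H * J)) := by gcongr
    _ = _ := by ring

theorem stmt19 {N : ℕ} (W : WeightFunction) (g : SchwartzMap (RN N) ℂ)
    (hg : SOmega W ⇑g) (hg0 : ⇑g ≠ 0)
    (p r : ℝ≥0∞) (hp : 1 ≤ p) (hr : 1 / (2 * p) + 1 / r = 1)
    (lam μ : ℝ) (hlam : 0 ≤ lam) (hμ : 2 * (N : ℝ) / (W.b * r.toReal) < μ)
    (f : SchwartzMap (RN N) ℂ) (hf : SOmega W ⇑f) :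
    wnorm W lam MeasureTheory.volume (fun z : RN N × RN N => rihaczek ⇑f z.1 z.2) ⊤ ≤
      ENNReal.ofReal (((2 * Real.pi) ^ (2 * N))⁻¹ *
        ((MeasureTheory.eLpNorm ⇑g 2 MeasureTheory.volume).toReal ^ 4)⁻¹ *
        Real.exp (W.K * (1 + 2 * W.K) * lam) *
        (wnorm W (W.K ^ 2 * lam) MeasureTheory.volume ⇑g ⊤).toReal *
        (wnorm W (W.K ^ 2 * lam) MeasureTheory.volume (ftr ⇑g) ⊤).toReal *
        ((MeasureTheory.eLpNorm
          (fun z : RN N × RN N => Real.exp (-(μ * W.w ‖z‖))) r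
          MeasureTheory.volume).toReal) ^ 2) *
      wnorm W (2 * (W.K ^ 2 * lam + μ)) MeasureTheory.volume
        (fun z : RN N × RN N => spec ⇑g ⇑f z.1 z.2) p := by
  have hK := W.oneLeK
  have hκ0 : 0 ≤ W.K ^ 2 * lam := by positivity
  have hgt : eLpNorm g 2 volume ≠ ⊤ := (SchwartzMap.eLpNorm_lt_top g 2 volume).ne
  have hgz : eLpNorm g 2 volume ≠ 0 := by
    rw [Ne, eLpNorm_eq_zero_iff g.continuous.aestronglyMeasurable two_ne_zero]
    intro h
    exact hg0 (g.continuous.ae_eq_iff_eq volume continuous_zero |>.1 h)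
  have hGH := hg (W.K ^ 2 * lam + 1) (by positivity)
  have hGt : wnorm W (W.K ^ 2 * lam) volume g ⊤ ≠ ⊤ := wnorm_top_ne_top W g hGH.1.choose_spec
  have hHt : wnorm W (W.K ^ 2 * lam) volume (ftr g) ⊤ ≠ ⊤ :=
    wnorm_top_ne_top W (ftr g) hGH.2.choose_spec
  obtain ⟨hr0, hrt⟩ := ne_zero_and_ne_top_of_holder hp hr
  have hSt := eLpNorm_exp_neg_ne_top W hr0 hrt hμ
  have hJP := sq_lintegral_weight_stft_le W g f hr (W.K ^ 2 * lam) μ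
  have hmain := pow_mul_enorm_weight_rihaczek_le W g f hlam (by ring) hGt hHt
  rw [wnorm, eLpNorm_exponent_top]
  refine eLpNormEssSup_le_of_ae_enorm_bound (.of_forall fun z => ?_)
  have hz := (hmain z.1 z.2).trans (mul_le_mul_right hJP _)
  rw [Prod.mk.eta] at hz
  have hA0 : eLpNorm g 2 volume ^ 4 ≠ 0 := pow_ne_zero 4 hgz
  have hAt : eLpNorm g 2 volume ^ 4 ≠ ⊤ := ENNReal.pow_ne_top hgt
  rw [← ENNReal.mul_le_mul_iff_right hA0 hAt]
  refine hz.trans_eq ?_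
  rw [ENNReal.ofReal_mul (by positivity), ENNReal.ofReal_mul (by positivity),
    ENNReal.ofReal_mul (by positivity), ENNReal.ofReal_mul (by positivity),
    ENNReal.ofReal_mul (by positivity), ENNReal.ofReal_pow (by positivity),
    ENNReal.ofReal_toReal hGt, ENNReal.ofReal_toReal hHt, ENNReal.ofReal_toReal hSt,
    ENNReal.ofReal_inv_of_pos (pow_pos (ENNReal.toReal_pos hgz hgt) 4),
    ENNReal.ofReal_pow (by positivity), ENNReal.ofReal_toReal hgt,
    show W.K * lam + 2 * (W.K ^ 2 * lam) = W.K * (1 + 2 * W.K) * lam by ring]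
  generalize eLpNorm g 2 volume ^ 4 = A at *
  generalize wnorm W (W.K ^ 2 * lam) volume g ⊤ = G
  generalize wnorm W (W.K ^ 2 * lam) volume (ftr g) ⊤ = H
  generalize eLpNorm (fun z : RN N × RN N => Real.exp (-(μ * W.w ‖z‖))) r volume = S
  generalize wnorm W (2 * (W.K ^ 2 * lam + μ)) volume
    (fun z : RN N × RN N => spec g f z.1 z.2) p = P
  generalize ENNReal.ofReal (((2 * Real.pi) ^ (2 * N))⁻¹) = c
  generalize ENNReal.ofReal (Real.exp (W.K * (1 + 2 * W.K) * lam)) = E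
  calc c * E * G * H * (S ^ 2 * P) = (A * A⁻¹) * (c * E * G * H * (S ^ 2 * P)) := by
        rw [ENNReal.mul_inv_cancel hA0 hAt, one_mul]
    _ = _ := by ring
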